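/- arXiv:0805.0016 — 2 statements merged into one kernel-verified Lean document; each statement's English description precedes it below -/
import Mathlib

section
/- There exists a 3-symmetric set P of 36 points in general position in the plane with cr(P) = 21174. In particular, the rectilinear crossing number satisfies cr(K_36) ≤ 21174 (improving the previously best known bound of 21175). -/
/-- A finite planar point set is in general position if no three of its points are collinear. -/
def GenPos (P : Finset (ℝ × ℝ)) : Prop :=
  ∀ p ∈ P, ∀ q ∈ P, ∀ r ∈ P, p ≠ q → p ≠ r → q ≠ r →
    ¬ Collinear ℝ ({p, q, r} : Set (ℝ × ℝ))

/-- A set of points is in convex position if no point lies in the convex hull of the others. -/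
def ConvexPos (S : Set (ℝ × ℝ)) : Prop :=
  ∀ p ∈ S, p ∉ convexHull ℝ (S \ {p})

/-- `crNum P` is the number of 4-element subsets of `P` in convex position. -/
noncomputable def crNum (P : Finset (ℝ × ℝ)) : ℕ :=
  Set.ncard {Q : Finset (ℝ × ℝ) | Q ⊆ P ∧ Q.card = 4 ∧ ConvexPos (↑Q : Set (ℝ × ℝ))}

/-- The rectilinear crossing number of `K_n`: the minimum of `crNum P` over all sets `P` of `n`
points in general position in the plane. -/
noncomputable def rcn (n : ℕ) : ℕ :=
  sInf {c : ℕ | ∃ P : Finset (ℝ × ℝ), P.card = n ∧ GenPos P ∧ crNum P = c}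

/-- Rotation by angle `2π/3` about the point `o`. -/
noncomputable def rot120 (o p : ℝ × ℝ) : ℝ × ℝ :=
  (o.1 + Real.cos (2 * Real.pi / 3) * (p.1 - o.1) - Real.sin (2 * Real.pi / 3) * (p.2 - o.2),
   o.2 + Real.sin (2 * Real.pi / 3) * (p.1 - o.1) + Real.cos (2 * Real.pi / 3) * (p.2 - o.2))

/-- A planar point set is 3-symmetric if some rotation by `2π/3` about a point not in the set
maps the set onto itself. -/
def ThreeSym (P : Finset (ℝ × ℝ)) : Prop :=
  ∃ o : ℝ × ℝ, o ∉ P ∧ rot120 o '' (P : Set (ℝ × ℝ)) = (P : Set (ℝ × ℝ))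

/-! ### Orientation and convex position in the plane -/

/-- Twice the signed area of the triangle `abc`. -/
def signedArea (a b c : ℝ × ℝ) : ℝ :=
  (b.1 - a.1) * (c.2 - a.2) - (b.2 - a.2) * (c.1 - a.1)

theorem signedArea_eq_zero_of_collinear {a b c : ℝ × ℝ}
    (h : Collinear ℝ ({a, b, c} : Set (ℝ × ℝ))) : signedArea a b c = 0 := by
  obtain ⟨v, hv⟩ := (collinear_iff_of_mem (p₀ := a) (by simp)).1 h
  obtain ⟨r, rfl⟩ := hv b (by simp)
  obtain ⟨s, rfl⟩ := hv c (by simp)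
  simp only [signedArea, vadd_eq_add, Prod.fst_add, Prod.snd_add, Prod.smul_fst, Prod.smul_snd,
    smul_eq_mul]
  ring

theorem mem_convexHull_triple {a b c p : ℝ × ℝ} :
    p ∈ convexHull ℝ ({a, b, c} : Set (ℝ × ℝ)) ↔
      ∃ u v w : ℝ, 0 ≤ u ∧ 0 ≤ v ∧ 0 ≤ w ∧ u + v + w = 1 ∧ u • a + v • b + w • c = p := by
  constructor
  · intro h
    rw [convexHull_insert (by simp), convexHull_pair, mem_convexJoin] at h
    obtain ⟨_, rfl, y, ⟨s, t, hs, ht, hst, rfl⟩, u, v, hu, hv, huv, rfl⟩ := h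
    refine ⟨u, v * s, v * t, hu, mul_nonneg hv hs, mul_nonneg hv ht, ?_, ?_⟩
    · rw [add_assoc, ← mul_add, hst, mul_one, huv]
    · simp only [smul_add, smul_smul, add_assoc]
  · rintro ⟨u, v, w, hu, hv, hw, h, rfl⟩
    have hmem : ∀ x ∈ ({a, b, c} : Set (ℝ × ℝ)), x ∈ convexHull ℝ ({a, b, c} : Set (ℝ × ℝ)) :=
      fun x hx => subset_convexHull ℝ _ hx
    have := (convex_convexHull ℝ ({a, b, c} : Set (ℝ × ℝ))).sum_mem (t := Finset.univ)
      (w := ![u, v, w]) (z := ![a, b, c]) (by simp [Fin.forall_fin_succ, hu, hv, hw])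
      (by simp [Fin.sum_univ_three, h]) (by
        intro i _
        fin_cases i <;> exact hmem _ (by simp))
    simpa [Fin.sum_univ_three] using this

theorem mem_convexHull_triple_iff_signedArea {a b c p : ℝ × ℝ} (h : signedArea a b c ≠ 0) :
    p ∈ convexHull ℝ ({a, b, c} : Set (ℝ × ℝ)) ↔
      0 ≤ signedArea p b c * signedArea a b c ∧ 0 ≤ signedArea a p c * signedArea a b c ∧
        0 ≤ signedArea a b p * signedArea a b c := by
  have hsq : 0 < signedArea a b c * signedArea a b c := mul_self_pos.2 h
  rw [mem_convexHull_triple]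
  constructor
  · rintro ⟨u, v, w, hu, hv, hw, hs, rfl⟩
    obtain rfl : u = 1 - v - w := by linarith
    refine ⟨(mul_nonneg hu hsq.le).trans_eq ?_, (mul_nonneg hv hsq.le).trans_eq ?_,
      (mul_nonneg hw hsq.le).trans_eq ?_⟩ <;>
    · simp only [signedArea, Prod.fst_add, Prod.snd_add, Prod.smul_fst, Prod.smul_snd,
        smul_eq_mul]
      ring
  · rintro ⟨h₁, h₂, h₃⟩
    refine ⟨_, _, _, div_nonneg h₁ hsq.le, div_nonneg h₂ hsq.le, div_nonneg h₃ hsq.le, ?_, ?_⟩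
    · rw [mul_div_mul_right _ _ h, mul_div_mul_right _ _ h, mul_div_mul_right _ _ h]
      field_simp
      simp only [signedArea]
      ring
    · rw [mul_div_mul_right _ _ h, mul_div_mul_right _ _ h, mul_div_mul_right _ _ h]
      ext <;>
      · simp only [Prod.fst_add, Prod.snd_add, Prod.smul_fst, Prod.smul_snd, smul_eq_mul]
        field_simp
        simp only [signedArea]
        ring

/-- Four points, no three of them collinear, are in convex position iff an even number of the four
triangles they span is positively oriented. -/
theorem convexPos_quadruple_iff {a b c d : ℝ × ℝ} (habc : signedArea a b c ≠ 0)
    (habd : signedArea a b d ≠ 0) (hacd : signedArea a c d ≠ 0) (hbcd : signedArea b c d ≠ 0) :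
    ConvexPos {a, b, c, d} ↔
      ((0 < signedArea a b c ↔ 0 < signedArea a b d) ↔
        (0 < signedArea a c d ↔ 0 < signedArea b c d)) := by
  have ne₁₂ : a ≠ b := by rintro rfl; simp [signedArea] at habc
  have ne₁₃ : a ≠ c := by rintro rfl; simp [signedArea] at habc
  have ne₁₄ : a ≠ d := by rintro rfl; simp [signedArea] at habd
  have ne₂₃ : b ≠ c := by rintro rfl; apply habc; simp only [signedArea]; ring
  have ne₂₄ : b ≠ d := by rintro rfl; apply habd; simp only [signedArea]; ring
  have ne₃₄ : c ≠ d := by rintro rfl; apply hacd; simp only [signedArea]; ring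
  have da : ({a, b, c, d} : Set (ℝ × ℝ)) \ {a} = {b, c, d} := by grind
  have db : ({a, b, c, d} : Set (ℝ × ℝ)) \ {b} = {a, c, d} := by grind
  have dc : ({a, b, c, d} : Set (ℝ × ℝ)) \ {c} = {a, b, d} := by grind
  have dd : ({a, b, c, d} : Set (ℝ × ℝ)) \ {d} = {a, b, c} := by grind
  have e₁ : signedArea b a d = -signedArea a b d := by simp only [signedArea]; ring
  have e₂ : signedArea b c a = signedArea a b c := by simp only [signedArea]; ring
  have e₃ : signedArea a c b = -signedArea a b c := by simp only [signedArea]; ring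
  have e₄ : signedArea c b d = -signedArea b c d := by simp only [signedArea]; ring
  have e₅ : signedArea d b c = signedArea b c d := by simp only [signedArea]; ring
  have e₆ : signedArea a d c = -signedArea a c d := by simp only [signedArea]; ring
  have hsum : signedArea b c d - signedArea a c d + signedArea a b d - signedArea a b c = 0 := by
    simp only [signedArea]; ring
  simp only [ConvexPos, Set.mem_insert_iff, Set.mem_singleton_iff, forall_eq_or_imp, forall_eq,
    da, db, dc, dd, mem_convexHull_triple_iff_signedArea habc,
    mem_convexHull_triple_iff_signedArea habd, mem_convexHull_triple_iff_signedArea hacd,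
    mem_convexHull_triple_iff_signedArea hbcd, e₁, e₂, e₃, e₄, e₅, e₆]
  generalize signedArea a b c = z at *
  generalize signedArea a b d = y at *
  generalize signedArea a c d = x at *
  generalize signedArea b c d = w at *
  rcases lt_or_gt_of_ne habc with hz | hz <;> rcases lt_or_gt_of_ne habd with hy | hy <;>
    rcases lt_or_gt_of_ne hacd with hx | hx <;> rcases lt_or_gt_of_ne hbcd with hw | hw <;>
    first
    | exfalso; linarith
    | simp [mul_nonneg_iff, mul_pos_of_neg_of_neg, hw, hx, hy, hz, hw.le, hx.le, hy.le, hz.le,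
        hw.not_ge, hx.not_ge, hy.not_ge, hz.not_ge, hw.not_gt, hx.not_gt, hy.not_gt, hz.not_gt]

/-! ### Counting the `k`-element subsets with a given property -/

/-- The number of length-`k` sublists of a list satisfying a Boolean predicate. -/
def countSublists {α : Type*} : ℕ → (List α → Bool) → List α → ℕ
  | 0, p, _ => bif p [] then 1 else 0
  | _ + 1, _, [] => 0
  | k + 1, p, a :: l => countSublists (k + 1) p l + countSublists k (fun t => p (a :: t)) l

theorem card_filter_powersetCard_toFinset {α : Type*} [DecidableEq α] {l : List α}
    (hl : l.Nodup) (k : ℕ) (p : List α → Bool) (q : Finset α → Prop) [DecidablePred q]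
    (h : ∀ t : List α, t.Sublist l → t.length = k → (q t.toFinset ↔ p t = true)) :
    ((l.toFinset.powersetCard k).filter q).card = countSublists k p l := by
  classical
  induction l generalizing k p q with
  | nil =>
    cases k with
    | zero =>
      have := h [] (List.Sublist.refl _) rfl
      rw [List.toFinset_nil] at this
      cases hp : p [] <;> simp [countSublists, Finset.filter_singleton, this, hp]
    | succ k => simp [countSublists]
  | cons a l ih =>
    cases k with
    | zero =>
      have := h [] (List.nil_sublist _) rfl
      rw [List.toFinset_nil] at this
      cases hp : p [] <;> simp [countSublists, Finset.filter_singleton, this, hp]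
    | succ k =>
      obtain ⟨ha, hl⟩ := List.nodup_cons.1 hl
      have ha' : a ∉ l.toFinset := by simpa using ha
      have hnot : ∀ T ∈ l.toFinset.powersetCard k, a ∉ T := fun T hT haT =>
        ha' ((Finset.mem_powersetCard.1 hT).1 haT)
      rw [List.toFinset_cons, Finset.powersetCard_succ_insert ha', Finset.filter_union,
        Finset.card_union_of_disjoint, countSublists, Finset.filter_image,
        Finset.card_image_of_injOn, ih hl (k + 1) p q, ih hl k _ (fun T => q (insert a T))]
      · intro t ht hk
        rw [← List.toFinset_cons]
        exact h _ (ht.cons_cons a) (by simp [hk])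
      · exact fun t ht hk => h t (ht.cons a) hk
      · intro S hS T hT hST
        have hS' := hnot S (Finset.mem_filter.1 hS).1
        have hT' := hnot T (Finset.mem_filter.1 hT).1
        rw [← Finset.erase_insert hS', ← Finset.erase_insert hT']
        exact congrArg (fun U => Finset.erase U a) hST
      · rw [Finset.disjoint_left]
        intro T hT hT'
        obtain ⟨U, -, rfl⟩ := Finset.mem_image.1 (Finset.mem_filter.1 hT').1
        exact ha' ((Finset.mem_powersetCard.1 (Finset.mem_filter.1 hT).1).1
          (Finset.mem_insert_self a U))

/-! ### Points of the triangular lattice -/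

/-- The point of the triangular lattice with the given coordinates in the basis `1`, `e^(2πi/3)`. -/
noncomputable def latticePoint : ℕ × ℕ ↪ ℝ × ℝ where
  toFun p := (p.1 - p.2 / 2, √3 / 2 * p.2)
  inj' p q h := by
    simp only [Prod.mk.injEq] at h
    obtain ⟨h₁, h₂⟩ := h
    have h₃ : (p.2 : ℝ) = q.2 := mul_left_cancel₀ (by positivity) h₂
    rw [h₃] at h₁
    have h₄ : (p.1 : ℝ) = q.1 := by linarith
    exact Prod.ext (by exact_mod_cast h₄) (by exact_mod_cast h₃)

/-- The positive part of the determinant giving the orientation of a lattice triangle, written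
with the operations of `Nat` that the kernel evaluates directly. -/
def detPos (a b c : ℕ × ℕ) : ℕ :=
  ((a.1.mul b.2).add (b.1.mul c.2)).add (c.1.mul a.2)

/-- The negative part of the determinant giving the orientation of a lattice triangle. -/
def detNeg (a b c : ℕ × ℕ) : ℕ :=
  ((a.1.mul c.2).add (b.1.mul a.2)).add (c.1.mul b.2)

/-- Whether a lattice triangle is positively oriented. -/
def isCCW (a b c : ℕ × ℕ) : Bool := Nat.blt (detNeg a b c) (detPos a b c)

/-- Equality of Booleans by case distinction, which the kernel evaluates faster than `==`. -/
def sameTruth : Bool → Bool → Bool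
  | true, b => b
  | false, b => !b

/-- Whether an even number of the triangles spanned by four lattice points is positively
oriented. -/
def isConvexQuad : List (ℕ × ℕ) → Bool
  | [a, b, c, d] => sameTruth (sameTruth (isCCW a b c) (isCCW a b d))
      (sameTruth (isCCW a c d) (isCCW b c d))
  | _ => false

/-- For lattice points `a`, `b`, `c` spanning a triangle of orientation `s`, the number of `d` in a
list such that an even number of the triangles spanned by `a`, `b`, `c`, `d` is positively
oriented. -/
def countFourth (a b c : ℕ × ℕ) (s : Bool) : List (ℕ × ℕ) → ℕ
  | [] => 0
  | d :: l => (countFourth a b c s l).add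
      (bif sameTruth (sameTruth s (isCCW a b d)) (sameTruth (isCCW a c d) (isCCW b c d))
        then 1 else 0)

/-- The number of pairs of list entries completing `a`, `b` to a quadruple as in `countFourth`. -/
def countThird (a b : ℕ × ℕ) : List (ℕ × ℕ) → ℕ
  | [] => 0
  | c :: l => (countThird a b l).add (countFourth a b c (isCCW a b c) l)

/-- The number of triples of list entries completing `a` to a quadruple as in `countFourth`. -/
def countSecond (a : ℕ × ℕ) : List (ℕ × ℕ) → ℕ
  | [] => 0
  | b :: l => (countSecond a l).add (countThird a b l)

/-- The number of quadruples of list entries as in `countFourth`, in a form that is cheap to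
evaluate. -/
def countConvexQuads : List (ℕ × ℕ) → ℕ
  | [] => 0
  | a :: l => (countConvexQuads l).add (countSecond a l)

theorem countSublists_isConvexQuad (l : List (ℕ × ℕ)) :
    countSublists 4 isConvexQuad l = countConvexQuads l := by
  have fourth : ∀ a b c l, countSublists 1 (fun t => isConvexQuad (a :: b :: c :: t)) l =
      countFourth a b c (isCCW a b c) l := by
    intro a b c l
    induction l with
    | nil => rfl
    | cons d l ih => rw [countSublists, ih, countSublists]; rfl
  have third : ∀ a b l, countSublists 2 (fun t => isConvexQuad (a :: b :: t)) l =
      countThird a b l := by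
    intro a b l
    induction l with
    | nil => rfl
    | cons c l ih => rw [countSublists, ih, fourth]; rfl
  have second : ∀ a l, countSublists 3 (fun t => isConvexQuad (a :: t)) l =
      countSecond a l := by
    intro a l
    induction l with
    | nil => rfl
    | cons b l ih => rw [countSublists, ih, third]; rfl
  induction l with
  | nil => rfl
  | cons a l ih => rw [countSublists, ih, second]; rfl

theorem latticePoint_apply (p : ℕ × ℕ) :
    latticePoint p = ((p.1 : ℝ) - p.2 / 2, √3 / 2 * (p.2 : ℝ)) := rfl

theorem signedArea_latticePoint (a b c : ℕ × ℕ) :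
    signedArea (latticePoint a) (latticePoint b) (latticePoint c) =
      √3 / 2 * ((detPos a b c : ℝ) - detNeg a b c) := by
  simp only [signedArea, latticePoint_apply, detPos, detNeg, Nat.add_eq, Nat.mul_eq]
  push_cast
  ring

theorem signedArea_latticePoint_ne_zero {a b c : ℕ × ℕ} (h : detPos a b c ≠ detNeg a b c) :
    signedArea (latticePoint a) (latticePoint b) (latticePoint c) ≠ 0 := by
  rw [signedArea_latticePoint]
  exact mul_ne_zero (by positivity) (sub_ne_zero.2 (by exact_mod_cast h))

theorem signedArea_latticePoint_pos {a b c : ℕ × ℕ} :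
    0 < signedArea (latticePoint a) (latticePoint b) (latticePoint c) ↔ isCCW a b c = true := by
  rw [signedArea_latticePoint, mul_pos_iff_of_pos_left (by positivity), sub_pos, Nat.cast_lt,
    isCCW, Nat.blt_eq]

theorem rot120_latticePoint {m : ℕ} {p q : ℕ × ℕ} (h₁ : q.1 + p.2 = 2 * m)
    (h₂ : q.2 + p.2 = m + p.1) :
    rot120 (latticePoint (m, m)) (latticePoint p) = latticePoint q := by
  have hcos : Real.cos (2 * Real.pi / 3) = -1 / 2 := by
    rw [show 2 * Real.pi / 3 = Real.pi - Real.pi / 3 by ring, Real.cos_pi_sub,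
      Real.cos_pi_div_three]
    norm_num
  have hsin : Real.sin (2 * Real.pi / 3) = √3 / 2 := by
    rw [show 2 * Real.pi / 3 = Real.pi - Real.pi / 3 by ring, Real.sin_pi_sub,
      Real.sin_pi_div_three]
  have hsqrt : √3 * √3 = 3 := Real.mul_self_sqrt (by norm_num)
  have h₁' : (q.1 : ℝ) = 2 * m - p.2 := by rw [eq_sub_iff_add_eq]; exact_mod_cast h₁
  have h₂' : (q.2 : ℝ) = m + p.1 - p.2 := by rw [eq_sub_iff_add_eq]; exact_mod_cast h₂
  simp only [rot120, latticePoint_apply, hcos, hsin, h₁', h₂',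
    Prod.mk.injEq]
  constructor
  · linear_combination (-(1 / 4) * ((p.2 : ℝ) - m)) * hsqrt
  · ring

theorem threeSym_map_latticePoint {S : Finset (ℕ × ℕ)} {m : ℕ} (hm : (m, m) ∉ S)
    (himage : ∀ p ∈ S, ∃ q ∈ S, q.1 + p.2 = 2 * m ∧ q.2 + p.2 = m + p.1)
    (hpreimage : ∀ q ∈ S, ∃ p ∈ S, q.1 + p.2 = 2 * m ∧ q.2 + p.2 = m + p.1) :
    ThreeSym (S.map latticePoint) := by
  refine ⟨latticePoint (m, m), by simpa using hm, ?_⟩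
  rw [Finset.coe_map]
  apply Set.Subset.antisymm
  · rintro _ ⟨_, ⟨p, hp, rfl⟩, rfl⟩
    obtain ⟨q, hq, h₁, h₂⟩ := himage p hp
    exact ⟨q, hq, (rot120_latticePoint h₁ h₂).symm⟩
  · rintro _ ⟨q, hq, rfl⟩
    obtain ⟨p, hp, h₁, h₂⟩ := hpreimage q hq
    exact ⟨_, ⟨p, hp, rfl⟩, rot120_latticePoint h₁ h₂⟩

theorem genPos_map_latticePoint {S : Finset (ℕ × ℕ)}
    (h : ∀ a ∈ S, ∀ b ∈ S, ∀ c ∈ S, detPos a b c ≠ detNeg a b c ∨ a = b ∨ a = c ∨ b = c) :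
    GenPos (S.map latticePoint) := by
  intro p hp q hq r hr hpq hpr hqr hcol
  obtain ⟨a, ha, rfl⟩ := Finset.mem_map.1 hp
  obtain ⟨b, hb, rfl⟩ := Finset.mem_map.1 hq
  obtain ⟨c, hc, rfl⟩ := Finset.mem_map.1 hr
  rcases h a ha b hb c hc with h | rfl | rfl | rfl
  · exact signedArea_latticePoint_ne_zero h (signedArea_eq_zero_of_collinear hcol)
  · exact hpq rfl
  · exact hpr rfl
  · exact hqr rfl

theorem crNum_map_latticePoint {l : List (ℕ × ℕ)} (hl : l.Nodup)
    (h : ∀ a ∈ l, ∀ b ∈ l, ∀ c ∈ l, detPos a b c ≠ detNeg a b c ∨ a = b ∨ a = c ∨ b = c) :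
    crNum (l.toFinset.map latticePoint) = countConvexQuads l := by
  classical
  have hset : {Q : Finset (ℝ × ℝ) | Q ⊆ l.toFinset.map latticePoint ∧ Q.card = 4 ∧
      ConvexPos (↑Q : Set (ℝ × ℝ))} = ↑(((l.toFinset.powersetCard 4).filter fun T =>
        ConvexPos (T.map latticePoint : Finset (ℝ × ℝ))).map
          (Finset.mapEmbedding latticePoint).toEmbedding) := by
    ext Q
    simp only [Set.mem_ofPred_eq, Finset.coe_map, Set.mem_image, Finset.mem_coe, Finset.mem_filter,
      Finset.mem_powersetCard]
    constructor
    · rintro ⟨hQ, hcard, hconv⟩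
      obtain ⟨T, hT, rfl⟩ := Finset.subset_map_iff.1 hQ
      exact ⟨T, ⟨⟨hT, by simpa using hcard⟩, by simpa using hconv⟩, rfl⟩
    · rintro ⟨T, ⟨⟨hT, hcard⟩, hconv⟩, rfl⟩
      exact ⟨Finset.map_subset_map.2 hT, by simpa using hcard, by simpa using hconv⟩
  rw [crNum, hset, Set.ncard_coe_finset, Finset.card_map, ← countSublists_isConvexQuad]
  refine card_filter_powersetCard_toFinset hl 4 _ _ fun t ht hlen => ?_
  obtain ⟨a, b, c, d, rfl⟩ := List.length_eq_four.1 hlen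
  have hnodup := ht.nodup hl
  have hsub := ht.subset
  simp only [List.cons_subset, List.nodup_cons, List.mem_cons, not_or] at hnodup hsub
  obtain ⟨ha, hb, hc, hd, -⟩ := hsub
  have key : ∀ {x y z}, x ∈ l → y ∈ l → z ∈ l → x ≠ y → x ≠ z → y ≠ z →
      signedArea (latticePoint x) (latticePoint y) (latticePoint z) ≠ 0 := by
    intro x y z hx hy hz hxy hxz hyz
    apply signedArea_latticePoint_ne_zero
    simpa [hxy, hxz, hyz] using h x hx y hy z hz
  have himage : ((([a, b, c, d] : List (ℕ × ℕ)).toFinset.map latticePoint : Finset (ℝ × ℝ)) :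
      Set (ℝ × ℝ)) = {latticePoint a, latticePoint b, latticePoint c, latticePoint d} := by
    simp
  rw [himage, convexPos_quadruple_iff (key ha hb hc (by tauto) (by tauto) (by tauto))
    (key ha hb hd (by tauto) (by tauto) (by tauto)) (key ha hc hd (by tauto) (by tauto) (by tauto))
    (key hb hc hd (by tauto) (by tauto) (by tauto))]
  simp only [signedArea_latticePoint_pos, isConvexQuad]
  generalize isCCW a b c = u, isCCW a b d = v, isCCW a c d = w, isCCW b c d = x
  revert u v w x
  decide

/-! ### The drawing of `K_36` -/

/-- Lattice coordinates of 36 points, invariant under rotation by `2π/3` about `(700, 700)`. -/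
def drawingPoints : List (ℕ × ℕ) :=
  [(563, 229), (329, 850), (584, 311), (444, 809), (905, 843), (629, 477),
   (530, 786), (648, 527), (664, 578), (660, 751), (665, 751), (672, 750),
   (1171, 1034), (550, 179), (1089, 973), (591, 335), (557, 762), (923, 852),
   (614, 444), (873, 821), (822, 786), (649, 609), (649, 614), (650, 622),
   (366, 837), (1221, 1071), (427, 816), (1065, 956), (638, 495), (548, 771),
   (956, 870), (579, 752), (614, 736), (791, 740), (786, 735), (778, 728)]

theorem drawingPoints_nodup : drawingPoints.Nodup := by decide +kernel

theorem drawingPoints_nondegenerate : ∀ a ∈ drawingPoints, ∀ b ∈ drawingPoints,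
    ∀ c ∈ drawingPoints, detPos a b c ≠ detNeg a b c ∨ a = b ∨ a = c ∨ b = c := by
  have h : (drawingPoints.all fun a => drawingPoints.all fun b => drawingPoints.all fun c =>
      bif Nat.beq (detPos a b c) (detNeg a b c) then
        decide (a = b) || decide (a = c) || decide (b = c) else true) = true := by
    decide +kernel
  intro a ha b hb c hc
  have := List.all_eq_true.1 (List.all_eq_true.1 (List.all_eq_true.1 h a ha) b hb) c hc
  cases hdet : Nat.beq (detPos a b c) (detNeg a b c)
  · exact Or.inl (Nat.ne_of_beq_eq_false hdet)
  · exact Or.inr (by simpa [hdet, or_assoc] using this)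

theorem countConvexQuads_drawingPoints : countConvexQuads drawingPoints = 21174 := by
  decide +kernel

/-- There is a 3-symmetric set of 36 points in general position with exactly 21174 convex
quadrilaterals; in particular the rectilinear crossing number of `K_36` is at most 21174. -/
theorem exists_good_drawing_K36 :
    ∃ P : Finset (ℝ × ℝ), P.card = 36 ∧ GenPos P ∧ ThreeSym P ∧ crNum P = 21174 ∧
      rcn 36 ≤ 21174 := by
  have hcard : (drawingPoints.toFinset.map latticePoint).card = 36 := by
    rw [Finset.card_map, List.toFinset_card_of_nodup drawingPoints_nodup]
    rfl
  have hgen : GenPos (drawingPoints.toFinset.map latticePoint) :=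
    genPos_map_latticePoint (by simpa only [List.mem_toFinset] using drawingPoints_nondegenerate)
  have hsym : ThreeSym (drawingPoints.toFinset.map latticePoint) := by
    apply threeSym_map_latticePoint (m := 700) <;> simp only [List.mem_toFinset] <;>
      decide +kernel
  have hcr : crNum (drawingPoints.toFinset.map latticePoint) = 21174 :=
    (crNum_map_latticePoint drawingPoints_nodup drawingPoints_nondegenerate).trans
      countConvexQuads_drawingPoints
  exact ⟨_, hcard, hgen, hsym, hcr, Nat.sInf_le ⟨_, hcard, hgen, hcr⟩⟩
end

section
/- There exists a 3-symmetric set P of 54 points in general position in the plane with cr(P) = 115977. In particular, the rectilinear crossing number satisfies cr(K_54) ≤ 115977 (improving the previously best known bound of 115994). -/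
/-- Twice the signed area of the triangle `pqr`; it is positive when `pqr` is counterclockwise. -/
def orient (p q r : ℝ × ℝ) : ℝ :=
  (q.1 - p.1) * (r.2 - p.2) - (q.2 - p.2) * (r.1 - p.1)

lemma orient_rotate (p q r : ℝ × ℝ) : orient q r p = orient p q r := by
  unfold orient; ring

lemma orient_swap (p q r : ℝ × ℝ) : orient q p r = -orient p q r := by
  unfold orient; ring

lemma orient_swap_right (p q r : ℝ × ℝ) : orient p r q = -orient p q r := by
  unfold orient; ring

@[simp] lemma orient_self_left (p q : ℝ × ℝ) : orient p p q = 0 := by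
  unfold orient; ring

@[simp] lemma orient_self_right (p q : ℝ × ℝ) : orient p q q = 0 := by
  unfold orient; ring

@[simp] lemma orient_self_outer (p q : ℝ × ℝ) : orient p q p = 0 := by
  unfold orient; ring

lemma orient_four_term (a b c d : ℝ × ℝ) :
    orient b c d - orient a c d + orient a b d - orient a b c = 0 := by
  unfold orient; ring

lemma orient_eq_zero_of_collinear {p q r : ℝ × ℝ}
    (h : Collinear ℝ ({p, q, r} : Set (ℝ × ℝ))) : orient p q r = 0 := by
  obtain ⟨v, hv⟩ := (collinear_iff_of_mem (p₀ := p) (by simp)).1 h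
  obtain ⟨s, rfl⟩ := hv q (by simp)
  obtain ⟨t, rfl⟩ := hv r (by simp)
  simp only [orient, vadd_eq_add, Prod.fst_add, Prod.snd_add, Prod.smul_fst, Prod.smul_snd,
    smul_eq_mul]
  ring

/-- Membership in a triangle, via the signs of the barycentric coordinates. -/
lemma mem_convexHull_triple_iff {a b c x : ℝ × ℝ} (h : orient a b c ≠ 0) :
    x ∈ convexHull ℝ ({a, b, c} : Set (ℝ × ℝ)) ↔
      0 ≤ orient x b c * orient a b c ∧ 0 ≤ orient a x c * orient a b c ∧
        0 ≤ orient a b x * orient a b c := by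
  constructor
  · rw [← convexJoin_singleton_segment]
    intro hx
    simp only [mem_convexJoin, Set.mem_singleton_iff, exists_eq_left] at hx
    obtain ⟨_, ⟨s, t, hs, ht, hst, rfl⟩, u, v, hu, hv, huv, rfl⟩ := hx
    obtain rfl : s = 1 - t := by linarith
    obtain rfl : u = 1 - v := by linarith
    have key := mul_self_nonneg (orient a b c)
    refine ⟨(mul_nonneg hu key).trans_eq ?_, (mul_nonneg (mul_nonneg hv hs) key).trans_eq ?_,
      (mul_nonneg (mul_nonneg hv ht) key).trans_eq ?_⟩ <;>
    · simp only [orient, Prod.fst_add, Prod.snd_add, Prod.smul_fst, Prod.smul_snd, smul_eq_mul]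
      ring
  · rintro ⟨ha, hb, hc⟩
    have hw : ∀ {y : ℝ}, 0 ≤ y * orient a b c → 0 ≤ y / orient a b c := fun {y} hy => by
      rw [← mul_div_mul_right y _ h]
      exact div_nonneg hy (mul_self_nonneg _)
    have hmem := (convex_convexHull ℝ ({a, b, c} : Set (ℝ × ℝ))).sum_mem (t := Finset.univ)
      (w := ![orient x b c / orient a b c, orient a x c / orient a b c,
        orient a b x / orient a b c]) (z := ![a, b, c])
      (by intro i _; fin_cases i; exacts [hw ha, hw hb, hw hc])
      (by
        simp only [Fin.sum_univ_three, Matrix.cons_val]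
        field_simp
        unfold orient
        ring)
      (by intro i _; apply subset_convexHull; fin_cases i <;> simp)
    convert hmem
    simp only [Fin.sum_univ_three, Matrix.cons_val]
    ext
    · simp only [Prod.fst_add, Prod.smul_fst, smul_eq_mul]
      field_simp
      unfold orient
      ring
    · simp only [Prod.snd_add, Prod.smul_snd, smul_eq_mul]
      field_simp
      unfold orient
      ring

/-- No three points of `P` have a degenerate orientation. -/
def OrientNondegenerate (P : Finset (ℝ × ℝ)) : Prop :=
  ∀ p ∈ P, ∀ q ∈ P, ∀ r ∈ P, p ≠ q → p ≠ r → q ≠ r → orient p q r ≠ 0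

lemma OrientNondegenerate.genPos {P : Finset (ℝ × ℝ)} (h : OrientNondegenerate P) : GenPos P :=
  fun p hp q hq r hr hpq hpr hqr hcol =>
    h p hp q hq r hr hpq hpr hqr (orient_eq_zero_of_collinear hcol)

lemma OrientNondegenerate.mono {P Q : Finset (ℝ × ℝ)} (h : OrientNondegenerate P) (hQ : Q ⊆ P) :
    OrientNondegenerate Q :=
  fun p hp q hq r hr => h p (hQ hp) q (hQ hq) r (hQ hr)

lemma mul_nonneg_iff_pos_iff_pos {x y : ℝ} (hx : x ≠ 0) (hy : y ≠ 0) :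
    0 ≤ x * y ↔ (0 < x ↔ 0 < y) := by
  rcases hx.lt_or_gt with hx | hx <;> rcases hy.lt_or_gt with hy | hy
  · simp [hx.not_gt, hy.not_gt, (mul_pos_of_neg_of_neg hx hy).le]
  · simp [hx.not_gt, hy, (mul_neg_of_neg_of_pos hx hy).not_ge]
  · simp [hx, hy.not_gt, (mul_neg_of_pos_of_neg hx hy).not_ge]
  · simp [hx, hy, (mul_pos hx hy).le]

lemma neg_pos_iff_not_pos {x : ℝ} (hx : x ≠ 0) : 0 < -x ↔ ¬ 0 < x := by
  rw [neg_pos, not_lt]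
  exact ⟨le_of_lt, fun h => lt_of_le_of_ne h hx⟩

/-- Four points are in convex position iff an even number of the four triangles they span
(in a fixed order of the points) are clockwise. -/
lemma convexPos_four_iff {a b c d : ℝ × ℝ} (hα : orient b c d ≠ 0) (hβ : orient a c d ≠ 0)
    (hγ : orient a b d ≠ 0) (hδ : orient a b c ≠ 0) :
    ConvexPos {a, b, c, d} ↔
      ((0 < orient b c d ↔ 0 < orient a c d) ↔ (0 < orient a b d ↔ 0 < orient a b c)) := by
  have hab : a ≠ b := by rintro rfl; simp at hδ
  have hac : a ≠ c := by rintro rfl; simp at hδ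
  have had : a ≠ d := by rintro rfl; simp at hγ
  have hbc : b ≠ c := by rintro rfl; simp at hδ
  have hbd : b ≠ d := by rintro rfl; simp at hγ
  have hcd : c ≠ d := by rintro rfl; simp at hβ
  have ea : ({a, b, c, d} : Set (ℝ × ℝ)) \ {a} = {b, c, d} := by ext; simp; grind
  have eb : ({a, b, c, d} : Set (ℝ × ℝ)) \ {b} = {a, c, d} := by ext; simp; grind
  have ec : ({a, b, c, d} : Set (ℝ × ℝ)) \ {c} = {a, b, d} := by ext; simp; grind
  have ed : ({a, b, c, d} : Set (ℝ × ℝ)) \ {d} = {a, b, c} := by ext; simp; grind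
  have hsum := orient_four_term a b c d
  have h₁ : ¬ (0 < orient b c d ∧ ¬ 0 < orient a c d ∧ 0 < orient a b d ∧ ¬ 0 < orient a b c) := by
    rintro ⟨h, h', h'', h'''⟩; linarith
  have h₂ : ¬ (¬ 0 < orient b c d ∧ 0 < orient a c d ∧ ¬ 0 < orient a b d ∧ 0 < orient a b c) := by
    rintro ⟨h, h', h'', h'''⟩; linarith
  simp only [ConvexPos, Set.mem_insert_iff, Set.mem_singleton_iff, forall_eq_or_imp, forall_eq,
    ea, eb, ec, ed, mem_convexHull_triple_iff hα, mem_convexHull_triple_iff hβ,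
    mem_convexHull_triple_iff hγ, mem_convexHull_triple_iff hδ]
  rw [orient_swap a b d, orient_rotate a b c, orient_swap_right a b c, orient_swap b c d,
    ← orient_rotate d b c, orient_swap_right a c d,
    mul_nonneg_iff_pos_iff_pos hβ hα, mul_nonneg_iff_pos_iff_pos (neg_ne_zero.2 hγ) hα,
    mul_nonneg_iff_pos_iff_pos hδ hα, mul_nonneg_iff_pos_iff_pos hα hβ,
    mul_nonneg_iff_pos_iff_pos hγ hβ, mul_nonneg_iff_pos_iff_pos (neg_ne_zero.2 hδ) hβ,
    mul_nonneg_iff_pos_iff_pos (neg_ne_zero.2 hα) hγ, mul_nonneg_iff_pos_iff_pos hβ hγ,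
    mul_nonneg_iff_pos_iff_pos hδ hγ, mul_nonneg_iff_pos_iff_pos hα hδ,
    mul_nonneg_iff_pos_iff_pos (neg_ne_zero.2 hβ) hδ, mul_nonneg_iff_pos_iff_pos hγ hδ,
    neg_pos_iff_not_pos hα, neg_pos_iff_not_pos hβ, neg_pos_iff_not_pos hγ,
    neg_pos_iff_not_pos hδ]
  clear ea eb ec ed hsum hα hβ hγ hδ
  generalize (0 < orient b c d) = A at *
  generalize (0 < orient a c d) = B at *
  generalize (0 < orient a b d) = C at *
  generalize (0 < orient a b c) = D at *
  by_cases A <;> by_cases B <;> by_cases C <;> by_cases D <;> simp_all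

/-- The number of pairs consisting of an ordered pair `(p, q)` of points of `P` and an ordered pair
of points of `P` lying strictly to the left and strictly to the right of the line `pq`. -/
noncomputable def splitCount (P : Finset (ℝ × ℝ)) : ℕ :=
  ∑ p ∈ P, ∑ q ∈ P, {r ∈ P | 0 < orient p q r}.card * {r ∈ P | orient p q r < 0}.card

open Classical in
lemma splitCount_four {a b c d : ℝ × ℝ} (hα : orient b c d ≠ 0) (hβ : orient a c d ≠ 0)
    (hγ : orient a b d ≠ 0) (hδ : orient a b c ≠ 0) :
    splitCount {a, b, c, d} = if ConvexPos {a, b, c, d} then 4 else 6 := by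
  have hab : a ≠ b := by rintro rfl; simp at hδ
  have hac : a ≠ c := by rintro rfl; simp at hδ
  have had : a ≠ d := by rintro rfl; simp at hγ
  have hbc : b ≠ c := by rintro rfl; simp at hδ
  have hbd : b ≠ d := by rintro rfl; simp at hγ
  have hcd : c ≠ d := by rintro rfl; simp at hβ
  have hsum := orient_four_term a b c d
  have perms : ∀ p q r, orient p r q = -orient p q r ∧ orient q p r = -orient p q r ∧
      orient q r p = orient p q r ∧ orient r p q = orient p q r ∧
      orient r q p = -orient p q r := by
    intro p q r
    unfold orient
    refine ⟨?_, ?_, ?_, ?_, ?_⟩ <;> ring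
  simp only [convexPos_four_iff hα hβ hγ hδ, splitCount, Finset.card_filter]
  simp only [Finset.sum_insert, Finset.sum_singleton, Finset.mem_insert, Finset.mem_singleton,
    hab, hac, had, hbc, hbd, hcd, or_self, not_false_eq_true, orient_self_left,
    orient_self_right, orient_self_outer, perms a b c, perms a b d, perms a c d, perms b c d,
    neg_pos, neg_lt_zero, lt_irrefl, if_false]
  rcases hα.lt_or_gt with h₁ | h₁ <;> rcases hβ.lt_or_gt with h₂ | h₂ <;>
    rcases hγ.lt_or_gt with h₃ | h₃ <;> rcases hδ.lt_or_gt with h₄ | h₄ <;>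
    first
    | linarith
    | simp [h₁, h₂, h₃, h₄, h₁.not_gt, h₂.not_gt, h₃.not_gt, h₄.not_gt]

lemma splitCount_eq_card (P : Finset (ℝ × ℝ)) :
    splitCount P = {t ∈ P ×ˢ P ×ˢ P ×ˢ P |
      0 < orient t.1 t.2.1 t.2.2.1 ∧ orient t.1 t.2.1 t.2.2.2 < 0}.card := by
  simp only [splitCount, Finset.card_filter, Finset.sum_product, Finset.sum_mul_sum, ← ite_and,
    ite_mul, one_mul, zero_mul]

lemma card_eq_four_of_split {p q r s : ℝ × ℝ} (hr : 0 < orient p q r) (hs : orient p q s < 0) :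
    ({p, q, r, s} : Finset (ℝ × ℝ)).card = 4 := by
  refine Finset.card_eq_four.2 ⟨p, q, r, s, ?_, ?_, ?_, ?_, ?_, ?_, rfl⟩ <;> rintro rfl
  all_goals first
    | exact hr.not_gt hs
    | simp at hr
    | simp at hs

/-- Two points separated by the line through two other points form with them exactly one
four-point subset. -/
lemma splitCount_eq_sum_powersetCard (P : Finset (ℝ × ℝ)) :
    splitCount P = ∑ Q ∈ P.powersetCard 4, splitCount Q := by
  rw [splitCount_eq_card, Finset.card_eq_sum_card_fiberwise
    (f := fun t => ({t.1, t.2.1, t.2.2.1, t.2.2.2} : Finset (ℝ × ℝ))) (t := P.powersetCard 4)]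
  · refine Finset.sum_congr rfl fun Q hQ => ?_
    rw [splitCount_eq_card]
    obtain ⟨hQP, hQ4⟩ := Finset.mem_powersetCard.1 hQ
    congr 1
    ext ⟨p, q, r, s⟩
    simp only [Finset.mem_filter, Finset.mem_product]
    constructor
    · rintro ⟨⟨-, h⟩, rfl⟩
      exact ⟨by simp, h⟩
    · rintro ⟨⟨hp, hq, hr, hs⟩, h⟩
      refine ⟨⟨⟨hQP hp, hQP hq, hQP hr, hQP hs⟩, h⟩, Finset.eq_of_subset_of_card_le ?_ ?_⟩
      · simp [Finset.insert_subset_iff, hp, hq, hr, hs]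
      · rw [card_eq_four_of_split h.1 h.2, hQ4]
  · rintro ⟨p, q, r, s⟩ ht
    simp only [Finset.coe_filter, Finset.mem_product, Set.mem_ofPred_eq] at ht
    obtain ⟨⟨hp, hq, hr, hs⟩, h⟩ := ht
    rw [Finset.mem_coe, Finset.mem_powersetCard]
    exact ⟨by simp [Finset.insert_subset_iff, hp, hq, hr, hs], card_eq_four_of_split h.1 h.2⟩

lemma OrientNondegenerate.splitCount_eq {P : Finset (ℝ × ℝ)} (h : OrientNondegenerate P) :
    splitCount P + 2 * crNum P = 6 * P.card.choose 4 := by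
  classical
  have hcr : crNum P = ∑ Q ∈ P.powersetCard 4, if ConvexPos (Q : Set (ℝ × ℝ)) then 1 else 0 := by
    rw [← Finset.card_filter, crNum, ← Set.ncard_coe_finset]
    congr 1
    ext Q
    simp [Finset.mem_powersetCard, and_assoc]
  rw [hcr, splitCount_eq_sum_powersetCard, Finset.mul_sum, ← Finset.sum_add_distrib,
    ← Finset.card_powersetCard, mul_comm, ← smul_eq_mul, ← Finset.sum_const]
  refine Finset.sum_congr rfl fun Q hQ => ?_
  obtain ⟨hQP, hQ4⟩ := Finset.mem_powersetCard.1 hQ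
  obtain ⟨a, b, c, d, hab, hac, had, hbc, hbd, hcd, rfl⟩ := Finset.card_eq_four.1 hQ4
  have hQ' := h.mono hQP
  rw [splitCount_four (hQ' b (by simp) c (by simp) d (by simp) hbc hbd hcd)
    (hQ' a (by simp) c (by simp) d (by simp) hac had hcd)
    (hQ' a (by simp) b (by simp) d (by simp) hab had hbd)
    (hQ' a (by simp) b (by simp) c (by simp) hab hac hbc)]
  simp only [Finset.coe_insert, Finset.coe_singleton]
  split_ifs <;> rfl

lemma OrientNondegenerate.card_left_add_card_right {P : Finset (ℝ × ℝ)}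
    (h : OrientNondegenerate P) {p q : ℝ × ℝ} (hp : p ∈ P) (hq : q ∈ P) (hpq : p ≠ q) :
    {r ∈ P | 0 < orient p q r}.card + {r ∈ P | orient p q r < 0}.card + 2 = P.card := by
  have hon : ({r ∈ P | ¬ 0 < orient p q r ∧ ¬ orient p q r < 0} : Finset (ℝ × ℝ)) = {p, q} := by
    ext r
    simp only [Finset.mem_filter, Finset.mem_insert, Finset.mem_singleton]
    constructor
    · rintro ⟨hr, hl, hr'⟩
      by_contra! hne
      exact h p hp q hq r hr hpq hne.1.symm hne.2.symm (le_antisymm (not_lt.1 hl) (not_lt.1 hr'))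
    · rintro (rfl | rfl) <;> simp [hp, hq]
  have hneg : ({r ∈ P | ¬ 0 < orient p q r ∧ orient p q r < 0} : Finset (ℝ × ℝ)) =
      {r ∈ P | orient p q r < 0} :=
    Finset.filter_congr fun r _ => ⟨And.right, fun hr => ⟨hr.not_gt, hr⟩⟩
  rw [← Finset.card_filter_add_card_filter_not (s := P) (fun r => 0 < orient p q r),
    ← Finset.card_filter_add_card_filter_not (s := {r ∈ P | ¬ 0 < orient p q r})
      (fun r => orient p q r < 0), Finset.filter_filter, Finset.filter_filter, hon, hneg,
    Finset.card_pair hpq, add_assoc]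

lemma OrientNondegenerate.splitCount_eq_sum_left {P : Finset (ℝ × ℝ)}
    (h : OrientNondegenerate P) :
    splitCount P = ∑ p ∈ P, ∑ q ∈ P, {r ∈ P | 0 < orient p q r}.card *
      (P.card - 2 - {r ∈ P | 0 < orient p q r}.card) := by
  refine Finset.sum_congr rfl fun p hp => Finset.sum_congr rfl fun q hq => ?_
  obtain rfl | hpq := eq_or_ne p q
  · simp
  · have := h.card_left_add_card_right hp hq hpq
    congr 1
    lia

/-- A symmetric predicate holding along a list holds for all distinct members of the list. -/
lemma List.Triplewise.forall_of_symm {α : Type*} {R : α → α → α → Prop} {l : List α}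
    (h : l.Triplewise R) (hswap : ∀ a b c, R a b c → R b a c)
    (hrot : ∀ a b c, R a b c → R b c a) {a b c : α} (ha : a ∈ l) (hb : b ∈ l) (hc : c ∈ l)
    (hab : a ≠ b) (hac : a ≠ c) (hbc : b ≠ c) : R a b c := by
  obtain ⟨i, hi, rfl⟩ := List.getElem_of_mem ha
  obtain ⟨j, hj, rfl⟩ := List.getElem_of_mem hb
  obtain ⟨k, hk, rfl⟩ := List.getElem_of_mem hc
  rw [List.triplewise_iff_getElem] at h
  have hij : i ≠ j := by rintro rfl; exact hab rfl
  have hik : i ≠ k := by rintro rfl; exact hac rfl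
  have hjk : j ≠ k := by rintro rfl; exact hbc rfl
  rcases hij.lt_or_gt with h₁ | h₁ <;> rcases hik.lt_or_gt with h₂ | h₂ <;>
    rcases hjk.lt_or_gt with h₃ | h₃
  · exact h i j k h₁ h₃ hk
  · exact hrot _ _ _ (hswap _ _ _ (h i k j h₂ h₃ hj))
  · lia
  · exact hrot _ _ _ (h k i j h₂ h₁ hj)
  · exact hswap _ _ _ (h j i k h₁ h₂ hk)
  · lia
  · exact hrot _ _ _ (hrot _ _ _ (h j k i h₃ h₂ hi))
  · exact hswap _ _ _ (hrot _ _ _ (h k j i h₃ h₁ hi))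

/-- The point with coordinates `p` in the lattice spanned by `1` and `exp (2πi/3)`. -/
noncomputable def latticeEmb (p : ℕ × ℕ) : ℝ × ℝ :=
  (p.1 - p.2 / 2, √3 / 2 * p.2)

lemma latticeEmb_injective : Function.Injective latticeEmb := by
  rintro ⟨a, b⟩ ⟨c, d⟩ h
  simp only [latticeEmb, Prod.mk.injEq] at h
  obtain ⟨h₁, h₂⟩ := h
  have hbd : (b : ℝ) = d := mul_left_cancel₀ (by positivity) h₂
  rw [hbd, sub_left_inj] at h₁
  exact Prod.ext (Nat.cast_injective h₁) (Nat.cast_injective hbd)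

/-- Whether the lattice point `r` lies strictly to the left of the directed line `pq`. -/
def isLeft (p q r : ℕ × ℕ) : Bool :=
  Nat.blt (p.2 * q.1 + (q.2 * r.1 + r.2 * p.1)) (p.1 * q.2 + (q.1 * r.2 + r.1 * p.2))

lemma isLeft_iff (p q r : ℕ × ℕ) :
    isLeft p q r ↔ 0 < orient (latticeEmb p) (latticeEmb q) (latticeEmb r) := by
  have h : orient (latticeEmb p) (latticeEmb q) (latticeEmb r) = √3 / 2 *
      (((p.1 * q.2 + (q.1 * r.2 + r.1 * p.2) : ℕ) : ℝ) -
        ((p.2 * q.1 + (q.2 * r.1 + r.2 * p.1) : ℕ) : ℝ)) := by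
    simp only [orient, latticeEmb]
    push_cast
    ring
  rw [h, mul_pos_iff_of_pos_left (by positivity), sub_pos, Nat.cast_lt, isLeft, Nat.blt_eq]

/-- Whether no three points of a list of lattice points are collinear. -/
def noThreeCollinear : List (ℕ × ℕ) → Bool
  | [] => true
  | a :: l => decide (l.Pairwise fun b c => isLeft a b c || isLeft b a c) && noThreeCollinear l

lemma triplewise_of_noThreeCollinear {l : List (ℕ × ℕ)} (h : noThreeCollinear l) :
    l.Triplewise fun a b c => orient (latticeEmb a) (latticeEmb b) (latticeEmb c) ≠ 0 := by
  induction l with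
  | nil => exact .nil
  | cons a l ih =>
    simp only [noThreeCollinear, Bool.and_eq_true, decide_eq_true_eq] at h
    refine .cons (h.1.imp fun {b c} hbc => ?_) (ih h.2)
    rw [Bool.or_eq_true, isLeft_iff, isLeft_iff,
      orient_swap (latticeEmb a) (latticeEmb b), neg_pos] at hbc
    exact hbc.elim ne_of_gt ne_of_lt

/-- The finite set of points of the plane given by a list of lattice points. -/
noncomputable def latticeSet (l : List (ℕ × ℕ)) : Finset (ℝ × ℝ) :=
  l.toFinset.map ⟨latticeEmb, latticeEmb_injective⟩

lemma mem_latticeSet {l : List (ℕ × ℕ)} {x : ℝ × ℝ} :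
    x ∈ latticeSet l ↔ ∃ p ∈ l, latticeEmb p = x := by
  simp [latticeSet]

lemma card_latticeSet {l : List (ℕ × ℕ)} (hl : l.Nodup) : (latticeSet l).card = l.length := by
  rw [latticeSet, Finset.card_map, List.toFinset_card_of_nodup hl]

lemma orientNondegenerate_latticeSet {l : List (ℕ × ℕ)} (h : noThreeCollinear l) :
    OrientNondegenerate (latticeSet l) := by
  intro x hx y hy z hz hxy hxz hyz
  obtain ⟨p, hp, rfl⟩ := mem_latticeSet.1 hx
  obtain ⟨q, hq, rfl⟩ := mem_latticeSet.1 hy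
  obtain ⟨r, hr, rfl⟩ := mem_latticeSet.1 hz
  refine (triplewise_of_noThreeCollinear h).forall_of_symm (fun a b c habc => ?_)
    (fun a b c habc => ?_) hp hq hr (ne_of_apply_ne _ hxy) (ne_of_apply_ne _ hxz)
    (ne_of_apply_ne _ hyz)
  · rwa [orient_swap, neg_ne_zero]
  · rwa [orient_rotate]

lemma splitCount_latticeSet {l : List (ℕ × ℕ)} (hl : l.Nodup) (h : noThreeCollinear l) :
    splitCount (latticeSet l) = (l.map fun p => (l.map fun q =>
      l.countP (isLeft p q) * (l.length - 2 - l.countP (isLeft p q))).sum).sum := by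
  have hcount : ∀ p q, {r ∈ latticeSet l | 0 < orient (latticeEmb p) (latticeEmb q) r}.card =
      l.countP (isLeft p q) := by
    intro p q
    rw [List.countP_eq_length_filter, ← List.toFinset_card_of_nodup (hl.filter _),
      List.toFinset_filter, latticeSet, Finset.filter_map, Finset.card_map]
    congr 1
    exact Finset.filter_congr fun r _ => (isLeft_iff p q r).symm
  rw [(orientNondegenerate_latticeSet h).splitCount_eq_sum_left, card_latticeSet hl,
    ← List.sum_toFinset _ hl]
  simp only [← List.sum_toFinset _ hl]
  rw [latticeSet, Finset.sum_map]
  refine Finset.sum_congr rfl fun p _ => ?_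
  rw [Finset.sum_map]
  refine Finset.sum_congr rfl fun q _ => ?_
  rw [← hcount p q]
  rfl

lemma rot120_latticeEmb {c p q : ℕ × ℕ} (h₁ : q.1 + p.2 = c.1 + c.2)
    (h₂ : q.2 + c.1 + p.2 = 2 * c.2 + p.1) :
    rot120 (latticeEmb c) (latticeEmb p) = latticeEmb q := by
  have hcos : Real.cos (2 * Real.pi / 3) = -(1 / 2) := by
    rw [show 2 * Real.pi / 3 = Real.pi - Real.pi / 3 by ring, Real.cos_pi_sub,
      Real.cos_pi_div_three]
  have hsin : Real.sin (2 * Real.pi / 3) = √3 / 2 := by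
    rw [show 2 * Real.pi / 3 = Real.pi - Real.pi / 3 by ring, Real.sin_pi_sub,
      Real.sin_pi_div_three]
  have h₁' : (q.1 : ℝ) = c.1 + c.2 - p.2 := by
    rw [eq_sub_iff_add_eq]; exact_mod_cast h₁
  have h₂' : (q.2 : ℝ) = 2 * c.2 + p.1 - p.2 - c.1 := by
    rw [eq_sub_iff_add_eq, eq_sub_iff_add_eq]; exact_mod_cast h₂
  have h3 : √3 * √3 = (3 : ℝ) := Real.mul_self_sqrt (by norm_num)
  simp only [rot120, latticeEmb, hcos, hsin, h₁', h₂']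
  ext
  · linear_combination (-(1 : ℝ) / 4) * (p.2 - c.2) * h3
  · ring

lemma threeSym_latticeSet {l : List (ℕ × ℕ)} (c : ℕ × ℕ) (hc : c ∉ l)
    (hto : ∀ p ∈ l, ∃ q ∈ l, q.1 + p.2 = c.1 + c.2 ∧ q.2 + c.1 + p.2 = 2 * c.2 + p.1)
    (hfrom : ∀ q ∈ l, ∃ p ∈ l, q.1 + p.2 = c.1 + c.2 ∧ q.2 + c.1 + p.2 = 2 * c.2 + p.1) :
    ThreeSym (latticeSet l) := by
  refine ⟨latticeEmb c, ?_, Set.Subset.antisymm ?_ ?_⟩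
  · rw [mem_latticeSet]
    rintro ⟨p, hp, hpc⟩
    exact hc (latticeEmb_injective hpc ▸ hp)
  · rintro _ ⟨x, hx, rfl⟩
    obtain ⟨p, hp, rfl⟩ := mem_latticeSet.1 hx
    obtain ⟨q, hq, h₁, h₂⟩ := hto p hp
    exact mem_latticeSet.2 ⟨q, hq, (rot120_latticeEmb h₁ h₂).symm⟩
  · intro y hy
    obtain ⟨q, hq, rfl⟩ := mem_latticeSet.1 hy
    obtain ⟨p, hp, h₁, h₂⟩ := hfrom q hq
    exact ⟨latticeEmb p, mem_latticeSet.2 ⟨p, hp, rfl⟩, rot120_latticeEmb h₁ h₂⟩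

/-- Lattice coordinates of a 3-symmetric set of 54 points centred at `(30000, 30000)`; each row
is an orbit. -/
def latticePoints : List (ℕ × ℕ) :=
  [(10205, 5326), (54674, 34879), (25121, 49795),
   (27437, 37333), (22667, 20104), (39896, 32563),
   (52448, 34367), (25633, 48081), (11919, 7552),
   (25375, 48927), (11073, 6448), (53552, 34625),
   (12591, 8349), (51651, 34242), (25758, 47409),
   (11417, 6879), (53121, 34538), (25462, 48583),
   (25248, 49358), (10642, 5890), (54110, 34752),
   (33832, 29374), (30626, 34458), (25542, 26168),
   (30445, 34620), (25380, 25825), (34175, 29555),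
   (27795, 41901), (18099, 15894), (44106, 32205),
   (40950, 32352), (27648, 38598), (21402, 19050),
   (51256, 34171), (25829, 47085), (12915, 8744),
   (30558, 34560), (25440, 25998), (34002, 29442),
   (33626, 29295), (30705, 34331), (25669, 26374),
   (28446, 31011), (28989, 27435), (32565, 31554),
   (23001, 20492), (39508, 32509), (27491, 36999),
   (18642, 16637), (43363, 32005), (27995, 41358),
   (41204, 32317), (27683, 38887), (21113, 18796)]

lemma noThreeCollinear_latticePoints : noThreeCollinear latticePoints := by
  decide +kernel

lemma nodup_latticePoints : latticePoints.Nodup := by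
  decide +kernel

lemma sum_left_mul_right_latticePoints :
    (latticePoints.map fun p => (latticePoints.map fun q =>
      latticePoints.countP (isLeft p q) *
        (latticePoints.length - 2 - latticePoints.countP (isLeft p q))).sum).sum = 1665552 := by
  decide +kernel

lemma crNum_latticePoints : crNum (latticeSet latticePoints) = 115977 := by
  have h := (orientNondegenerate_latticeSet noThreeCollinear_latticePoints).splitCount_eq
  rw [splitCount_latticeSet nodup_latticePoints noThreeCollinear_latticePoints,
    sum_left_mul_right_latticePoints, card_latticeSet nodup_latticePoints,
    show latticePoints.length = 54 from rfl, show Nat.choose 54 4 = 316251 by decide +kernel] at h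
  lia

/-- There is a 3-symmetric set of 54 points in general position with exactly 115977 convex
quadrilaterals; in particular the rectilinear crossing number of `K_54` is at most 115977. -/
theorem exists_good_drawing_K54 :
    ∃ P : Finset (ℝ × ℝ), P.card = 54 ∧ GenPos P ∧ ThreeSym P ∧ crNum P = 115977 ∧
      rcn 54 ≤ 115977 := by
  have hgen := (orientNondegenerate_latticeSet noThreeCollinear_latticePoints).genPos
  have hcard : (latticeSet latticePoints).card = 54 := card_latticeSet nodup_latticePoints
  exact ⟨latticeSet latticePoints, hcard, hgen,
    threeSym_latticeSet (30000, 30000) (by decide +kernel) (by decide +kernel)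
      (by decide +kernel),
    crNum_latticePoints, Nat.sInf_le ⟨_, hcard, hgen, crNum_latticePoints⟩⟩
end
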